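/- One-step interpolation identity (key step in the proof of Lemma 1): Let M = (S, A, T, r, μ₀, γ) and M̃ = (S, A, T̃, r, μ₀, γ) be two finite discounted MDPs differing only in their dynamics, and let π be a stationary stochastic policy. For each j ≥ 0 define W_j := E[Σ_{t=0}^∞ γ^t r(s_t, a_t)], where s_0 ∼ μ₀, a_t ∼ π(·|s_t), and s_{t+1} ∼ T̃(s_t, a_t) for t < j while s_{t+1} ∼ T(s_t, a_t) for t ≥ j. Then for every j ≥ 0, W_{j+1} − W_j = γ^{j+1} · E_{(s_j, a_j)}[G_M̃^π(s_j, a_j)], where (s_j, a_j) is the time-j state–action pair of the chain that follows π and the dynamics T̃ started from μ₀. Moreover W_0 = η_M(π) and W_j → η_M̃(π) as j → ∞. -/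

import Mathlib

open scoped BigOperators

/-- Expectation of a real-valued function under a `PMF` on a finite type. -/
noncomputable def pmfExp {X : Type*} [Fintype X] (d : PMF X) (f : X → ℝ) : ℝ :=
  ∑ x, (d x).toReal * f x

/-- Initial state–action distribution: `s ∼ μ`, `a ∼ π s`. -/
noncomputable def initSA {S A : Type*} (π : S → PMF A) (μ : PMF S) : PMF (S × A) :=
  μ.bind fun s => (π s).map fun a => (s, a)

/-- One step of the state–action Markov chain induced by dynamics `T` and policy `π`. -/
noncomputable def stepSA {S A : Type*} (T : S → A → PMF S) (π : S → PMF A)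
    (d : PMF (S × A)) : PMF (S × A) :=
  d.bind fun sa => (T sa.1 sa.2).bind fun s' => (π s').map fun a' => (s', a')

/-- Distribution of the time-`t` state–action pair of the chain started from `μ`. -/
noncomputable def saDist {S A : Type*} (T : S → A → PMF S) (π : S → PMF A)
    (μ : PMF S) : ℕ → PMF (S × A)
  | 0 => initSA π μ
  | (t + 1) => stepSA T π (saDist T π μ t)

/-- Unnormalized discounted occupancy expectation
`Ē_{(s,a)∼ρ_T^π}[f] = Σ_t γ^t E[f(s_t,a_t)]`, chain started from `μ`. -/
noncomputable def occExp {S A : Type*} [Fintype S] [Fintype A]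
    (T : S → A → PMF S) (π : S → PMF A) (μ : PMF S) (γ : ℝ) (f : S × A → ℝ) : ℝ :=
  ∑' t : ℕ, γ ^ t * pmfExp (saDist T π μ t) f

/-- Value function `V_M^π(s)` of the MDP with dynamics `T`, reward `r`, discount `γ`. -/
noncomputable def valueFun {S A : Type*} [Fintype S] [Fintype A]
    (T : S → A → PMF S) (π : S → PMF A) (r : S × A → ℝ) (γ : ℝ) (s : S) : ℝ :=
  occExp T π (PMF.pure s) γ r

/-- Expected return `η_M(π) = E_{s∼μ₀}[V_M^π(s)]`. -/
noncomputable def expReturn {S A : Type*} [Fintype S] [Fintype A]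
    (T : S → A → PMF S) (π : S → PMF A) (r : S × A → ℝ) (γ : ℝ) (μ : PMF S) : ℝ :=
  ∑ s, (μ s).toReal * valueFun T π r γ s

/-- Model-error gap `G_{M̃}^π(s,a) = E_{s'∼T̃(s,a)}[V_M^π(s')] − E_{s'∼T(s,a)}[V_M^π(s')]`,
where `T` is the true dynamics and `T'` the model dynamics. -/
noncomputable def Ggap {S A : Type*} [Fintype S] [Fintype A]
    (T T' : S → A → PMF S) (π : S → PMF A) (r : S × A → ℝ) (γ : ℝ) (sa : S × A) : ℝ :=
  (∑ s', ((T' sa.1 sa.2) s').toReal * valueFun T π r γ s') -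
    (∑ s', ((T sa.1 sa.2) s').toReal * valueFun T π r γ s')

/-- Distribution of the time- state–action pair of the chain that follows the switched
dynamics: transitions at step indices  use  (the model ), later ones use . -/
noncomputable def saDistSwitch {S A : Type*} (T T' : S → A → PMF S) (π : S → PMF A)
    (μ : PMF S) (j : ℕ) : ℕ → PMF (S × A)
  | 0 => initSA π μ
  | (t + 1) => stepSA (if t < j then T' else T) π (saDistSwitch T T' π μ j t)

/-- : expected discounted return when executing  with dynamics  for the
first  transition steps and  afterwards. -/
noncomputable def Wmix {S A : Type*} [Fintype S] [Fintype A]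
    (T T' : S → A → PMF S) (π : S → PMF A) (r : S × A → ℝ) (γ : ℝ) (μ : PMF S)
    (j : ℕ) : ℝ :=
  ∑' t : ℕ, γ ^ t * pmfExp (saDistSwitch T T' π μ j t) r

lemma pmfExp_bind {X Y : Type*} [Fintype X] [Fintype Y] (d : PMF X) (k : X → PMF Y) (f : Y → ℝ) :
    pmfExp (d.bind k) f = pmfExp d fun x => pmfExp (k x) f := by
  simp only [pmfExp, PMF.bind_apply, tsum_fintype, Finset.mul_sum]
  rw [Finset.sum_comm]
  refine Finset.sum_congr rfl fun y _ => ?_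
  rw [ENNReal.toReal_sum fun x _ =>
    ENNReal.mul_ne_top (PMF.apply_ne_top _ _) (PMF.apply_ne_top _ _), Finset.sum_mul]
  exact Finset.sum_congr rfl fun x _ => by rw [ENNReal.toReal_mul, mul_assoc]

lemma abs_pmfExp_le {X : Type*} [Fintype X] (d : PMF X) (f : X → ℝ) :
    |pmfExp d f| ≤ ∑ x, |f x| := by
  refine (Finset.abs_sum_le_sum_abs _ _).trans (Finset.sum_le_sum fun x _ => ?_)
  rw [abs_mul, abs_of_nonneg ENNReal.toReal_nonneg]
  exact mul_le_of_le_one_left (abs_nonneg _)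
    (ENNReal.toReal_le_of_le_ofReal zero_le_one (by simpa using d.coe_le_one x))

lemma norm_discounted_pmfExp_le {X : Type*} [Fintype X] {γ : ℝ} (hγ0 : 0 ≤ γ) (d : PMF X)
    (f : X → ℝ) (t : ℕ) : ‖γ ^ t * pmfExp d f‖ ≤ γ ^ t * ∑ x, |f x| := by
  rw [norm_mul, Real.norm_of_nonneg (pow_nonneg hγ0 t)]
  exact mul_le_mul_of_nonneg_left (abs_pmfExp_le d f) (pow_nonneg hγ0 t)

lemma summable_discounted_pmfExp {X : Type*} [Fintype X] {γ : ℝ} (hγ0 : 0 ≤ γ) (hγ1 : γ < 1)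
    (d : ℕ → PMF X) (f : X → ℝ) : Summable fun t => γ ^ t * pmfExp (d t) f :=
  ((summable_geometric_of_lt_one hγ0 hγ1).mul_right _).of_norm_bounded
    fun t => norm_discounted_pmfExp_le hγ0 (d t) f t

lemma stepSA_eq_initSA {S A : Type*} (T : S → A → PMF S) (π : S → PMF A) (d : PMF (S × A)) :
    stepSA T π d = initSA π (d.bind fun sa => T sa.1 sa.2) := by
  simp only [stepSA, initSA, PMF.bind_bind]

lemma saDist_eq_bind {S A : Type*} (T : S → A → PMF S) (π : S → PMF A) (μ : PMF S) (t : ℕ) :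
    saDist T π μ t = μ.bind fun s => saDist T π (PMF.pure s) t := by
  induction t with
  | zero => simp only [saDist, initSA, PMF.pure_bind]
  | succ t ih =>
    simp only [saDist]
    rw [ih]
    simp only [stepSA, PMF.bind_bind]

lemma expReturn_eq_occExp {S A : Type*} [Fintype S] [Fintype A] (T : S → A → PMF S)
    (π : S → PMF A) (r : S × A → ℝ) {γ : ℝ} (hγ0 : 0 ≤ γ) (hγ1 : γ < 1) (μ : PMF S) :
    expReturn T π r γ μ = occExp T π μ γ r := by
  simp only [expReturn, valueFun, occExp, ← tsum_mul_left]
  rw [← Summable.tsum_finsetSum fun s _ => (summable_discounted_pmfExp hγ0 hγ1 _ r).mul_left _]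
  refine tsum_congr fun t => ?_
  rw [saDist_eq_bind T π μ t, pmfExp_bind, pmfExp, Finset.mul_sum]
  exact Finset.sum_congr rfl fun s _ => mul_left_comm _ _ _

lemma saDistSwitch_of_le {S A : Type*} (T T' : S → A → PMF S) (π : S → PMF A) (μ : PMF S)
    {j t : ℕ} (h : t ≤ j) : saDistSwitch T T' π μ j t = saDist T' π μ t := by
  induction t with
  | zero => rfl
  | succ t ih =>
    rw [saDistSwitch, saDist, if_pos (Nat.lt_of_succ_le h), ih (Nat.le_of_succ_le h)]

lemma saDistSwitch_add {S A : Type*} (T T' : S → A → PMF S) (π : S → PMF A) (μ ν : PMF S)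
    {j k : ℕ} (hjk : j ≤ k) (h : saDistSwitch T T' π μ j k = initSA π ν) (t : ℕ) :
    saDistSwitch T T' π μ j (t + k) = saDist T π ν t := by
  induction t with
  | zero => simpa [saDist] using h
  | succ t ih =>
    rw [Nat.add_right_comm, saDistSwitch, if_neg (by omega), ih, saDist]

lemma Wmix_eq_sum_add_expReturn {S A : Type*} [Fintype S] [Fintype A] (T T' : S → A → PMF S)
    (π : S → PMF A) (r : S × A → ℝ) {γ : ℝ} (hγ0 : 0 ≤ γ) (hγ1 : γ < 1) (μ ν : PMF S)
    {j k : ℕ} (hjk : j ≤ k) (h : saDistSwitch T T' π μ j k = initSA π ν) :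
    Wmix T T' π r γ μ j =
      ∑ t ∈ Finset.range k, γ ^ t * pmfExp (saDistSwitch T T' π μ j t) r +
        γ ^ k * expReturn T π r γ ν := by
  rw [Wmix, ← (summable_discounted_pmfExp hγ0 hγ1 _ r).sum_add_tsum_nat_add k,
    expReturn_eq_occExp T π r hγ0 hγ1, occExp, ← tsum_mul_left]
  congr 1
  refine tsum_congr fun t => ?_
  rw [saDistSwitch_add T T' π μ ν hjk h, pow_add]
  ring

/-- **One-step interpolation identity (key step in the proof of Lemma 1).**
`W_{j+1} − W_j = γ^{j+1} · E_{(s_j,a_j)∼(π,T̃)}[G_{M̃}^π(s_j,a_j)]`, with `W_0 = η_M(π)`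
and `W_j → η_{M̃}(π)` as `j → ∞`. -/
theorem one_step_interpolation
    {S A : Type*} [Fintype S] [Fintype A] [Nonempty S] [Nonempty A]
    (T T' : S → A → PMF S) (r : S × A → ℝ) (μ₀ : PMF S) (γ : ℝ)
    (hγ0 : 0 ≤ γ) (hγ1 : γ < 1) (π : S → PMF A) :
    (∀ j : ℕ,
      Wmix T T' π r γ μ₀ (j + 1) - Wmix T T' π r γ μ₀ j =
        γ ^ (j + 1) * pmfExp (saDist T' π μ₀ j) (fun sa => Ggap T T' π r γ sa)) ∧
    Wmix T T' π r γ μ₀ 0 = expReturn T π r γ μ₀ ∧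
    Filter.Tendsto (fun j => Wmix T T' π r γ μ₀ j) Filter.atTop
      (nhds (expReturn T' π r γ μ₀)) := by
  refine ⟨fun j => ?_, ?_, ?_⟩
  · have h (U : S → A → PMF S) :
        expReturn T π r γ ((saDist T' π μ₀ j).bind fun sa => U sa.1 sa.2) =
          pmfExp (saDist T' π μ₀ j) fun sa => pmfExp (U sa.1 sa.2) (valueFun T π r γ) :=
      pmfExp_bind _ _ _
    have hsum : ∑ t ∈ Finset.range (j + 1), γ ^ t * pmfExp (saDistSwitch T T' π μ₀ (j + 1) t) r =
        ∑ t ∈ Finset.range (j + 1), γ ^ t * pmfExp (saDistSwitch T T' π μ₀ j t) r := by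
      refine Finset.sum_congr rfl fun t ht => ?_
      have ht' := Finset.mem_range.mp ht
      rw [saDistSwitch_of_le T T' π μ₀ ht'.le, saDistSwitch_of_le T T' π μ₀ (by omega)]
    rw [Wmix_eq_sum_add_expReturn T T' π r hγ0 hγ1 μ₀
        ((saDist T' π μ₀ j).bind fun sa => T' sa.1 sa.2) le_rfl
        (by rw [saDistSwitch_of_le T T' π μ₀ le_rfl, saDist, stepSA_eq_initSA]),
      Wmix_eq_sum_add_expReturn T T' π r hγ0 hγ1 μ₀
        ((saDist T' π μ₀ j).bind fun sa => T sa.1 sa.2) j.le_succ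
        (by rw [saDistSwitch, if_neg (lt_irrefl j), saDistSwitch_of_le T T' π μ₀ le_rfl,
          stepSA_eq_initSA]),
      hsum, add_sub_add_left_eq_sub, ← mul_sub, h, h]
    simp only [pmfExp, Ggap, mul_sub, Finset.sum_sub_distrib]
  · rw [Wmix_eq_sum_add_expReturn T T' π r hγ0 hγ1 μ₀ μ₀ le_rfl rfl]
    simp
  · rw [expReturn_eq_occExp T' π r hγ0 hγ1]
    refine tendsto_tsum_of_dominated_convergence
      ((summable_geometric_of_lt_one hγ0 hγ1).mul_right (∑ x, |r x|)) (fun t => ?_)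
      (Filter.Eventually.of_forall fun j t => norm_discounted_pmfExp_le hγ0 _ r t)
    refine tendsto_const_nhds.congr' ?_
    filter_upwards [Filter.eventually_ge_atTop t] with j hj
    rw [saDistSwitch_of_le T T' π μ₀ hj]
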